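/- arXiv:2304.03349 — 3 statements merged into one kernel-verified Lean document; each statement's English description precedes it below -/
import Mathlib

section
/- The double nested series Σ_{n=1}^{∞} [ Σ_{k=n+1}^{∞} (−1)^k ( 1/(4k−1) − 1/(4k−3) ) ]² equals π/16 − (1/4)·(ln(√2+1))². -/
open Real

/-- The inner tail sum `∑_{k=n+1}^∞ (−1)^k (1/(4k−1) − 1/(4k−3))`,
indexed so that `k = n + 1 + j`. -/
noncomputable def innerTail (n : ℕ) : ℝ :=
  ∑' j : ℕ, (-1 : ℝ) ^ (n + 1 + j) *
    (1 / (4 * ((n : ℝ) + 1 + j) - 1) - 1 / (4 * ((n : ℝ) + 1 + j) - 3))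

open MeasureTheory Filter Topology

/-- Up to the factor `1 / (2 * π)`, the Fourier coefficients of `x ↦ 1 / cos (x / 4)` on
`[-π, π]`. -/
noncomputable def secCoeff (t : ℝ) : ℝ :=
  ∫ x in (-π)..π, cos (t * x) / cos (x / 4)

lemma cos_div_four_pos {x : ℝ} (hx : x ∈ Set.Icc (-π) π) : 0 < cos (x / 4) := by
  apply cos_pos_of_mem_Ioo
  constructor <;> linarith [hx.1, hx.2, pi_pos]

lemma continuousOn_div_cos {f : ℝ → ℝ} (hf : Continuous f) :
    ContinuousOn (fun x => f x / cos (x / 4)) (Set.Icc (-π) π) :=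
  hf.continuousOn.div (by fun_prop) fun _ hx => (cos_div_four_pos hx).ne'

lemma intervalIntegrable_div_cos {f : ℝ → ℝ} (hf : Continuous f) :
    IntervalIntegrable (fun x => f x / cos (x / 4)) volume (-π) π := by
  apply ContinuousOn.intervalIntegrable
  rw [Set.uIcc_of_le (by linarith [pi_pos])]
  exact continuousOn_div_cos hf

lemma integral_cos_mul {a : ℝ} (ha : a ≠ 0) :
    ∫ x in (-π)..π, cos (a * x) = 2 * sin (a * π) / a := by
  rw [intervalIntegral.integral_comp_mul_left _ ha, integral_cos, mul_neg, sin_neg, smul_eq_mul]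
  field_simp
  ring

lemma secCoeff_sub_succ (n : ℕ) :
    secCoeff n - secCoeff (n + 1 : ℕ) = 8 * √2 *
      ((-1) ^ (n + 1) * (1 / (4 * ((n : ℝ) + 1) - 1) - 1 / (4 * ((n : ℝ) + 1) - 3))) := by
  have hpoint : secCoeff n - secCoeff (n + 1 : ℕ) =
      ∫ x in (-π)..π, 2 * (cos ((n + 1 / 4) * x) - cos ((n + 3 / 4) * x)) := by
    rw [secCoeff, secCoeff, ← intervalIntegral.integral_sub
      (intervalIntegrable_div_cos (by fun_prop)) (intervalIntegrable_div_cos (by fun_prop))]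
    refine intervalIntegral.integral_congr fun x hx => ?_
    rw [Set.uIcc_of_le (by linarith [pi_pos])] at hx
    have hcos := (cos_div_four_pos hx).ne'
    have h₁ : cos (n * x) = cos ((n + 1 / 4) * x - x / 4) := by ring_nf
    have h₂ : cos ((n + 1 : ℕ) * x) = cos ((n + 3 / 4) * x + x / 4) := by push_cast; ring_nf
    have h₃ : cos ((n + 1 / 4) * x + x / 4) = cos ((n + 3 / 4) * x - x / 4) := by ring_nf
    rw [cos_add, cos_sub] at h₃
    simp only [h₁, h₂]
    rw [← sub_div, div_eq_iff hcos, cos_sub, cos_add]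
    linear_combination -h₃
  have hn : (0 : ℝ) ≤ n := n.cast_nonneg
  have hs₁ : sin (((n : ℝ) + 1 / 4) * π) = (-1) ^ n * (√2 / 2) := by
    rw [← sin_pi_div_four, ← sin_add_nat_mul_pi]
    ring_nf
  have hs₂ : sin (((n : ℝ) + 3 / 4) * π) = (-1) ^ n * (√2 / 2) := by
    rw [← sin_pi_div_four, ← sin_pi_sub (π / 4), ← sin_add_nat_mul_pi]
    ring_nf
  rw [hpoint, intervalIntegral.integral_const_mul, intervalIntegral.integral_sub
    (Continuous.intervalIntegrable (by fun_prop) _ _)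
    (Continuous.intervalIntegrable (by fun_prop) _ _),
    integral_cos_mul (by positivity), integral_cos_mul (by positivity), hs₁, hs₂]
  have e₁ : (n : ℝ) + 1 / 4 = (4 * n + 1) / 4 := by ring
  have e₂ : (n : ℝ) + 3 / 4 = (4 * n + 3) / 4 := by ring
  have e₃ : 4 * ((n : ℝ) + 1) - 1 = 4 * n + 3 := by ring
  have e₄ : 4 * ((n : ℝ) + 1) - 3 = 4 * n + 1 := by ring
  rw [e₁, e₂, e₃, e₄, pow_succ]
  field_simp
  ring

lemma secCoeff_zero : secCoeff 0 = 8 * log (√2 + 1) := by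
  have hderiv : ∀ x ∈ Set.uIcc (-π) π,
      HasDerivAt (fun x => 4 * arsinh (tan (x / 4))) (cos (0 * x) / cos (x / 4)) x := by
    intro x hx
    rw [Set.uIcc_of_le (by linarith [pi_pos])] at hx
    have hcos := cos_div_four_pos hx
    have h := (((hasDerivAt_tan hcos.ne').comp x
      ((hasDerivAt_id x).div_const 4)).arsinh).const_mul 4
    refine h.congr_deriv ?_
    have hsqrt : √(1 + tan (x / 4) ^ 2) = (cos (x / 4))⁻¹ := by
      rw [← inv_sqrt_one_add_tan_sq hcos, inv_inv]
    simp only [Function.comp, id, hsqrt, zero_mul, cos_zero, smul_eq_mul]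
    field_simp
  rw [secCoeff, intervalIntegral.integral_eq_sub_of_hasDerivAt hderiv
    (intervalIntegrable_div_cos (by fun_prop)), neg_div, tan_neg, arsinh_neg, tan_pi_div_four,
    arsinh]
  norm_num
  ring_nf

lemma integral_inv_cos_sq : ∫ x in (-π)..π, (1 / cos (x / 4)) ^ 2 = 8 := by
  have hderiv : ∀ x ∈ Set.uIcc (-π) π,
      HasDerivAt (fun x => 4 * tan (x / 4)) ((1 / cos (x / 4)) ^ 2) x := by
    intro x hx
    rw [Set.uIcc_of_le (by linarith [pi_pos])] at hx
    have h := ((hasDerivAt_tan (cos_div_four_pos hx).ne').comp x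
      ((hasDerivAt_id x).div_const 4)).const_mul 4
    refine h.congr_deriv ?_
    field_simp
  have hInt : IntervalIntegrable (fun x => (1 / cos (x / 4)) ^ 2) volume (-π) π := by
    apply ContinuousOn.intervalIntegrable
    rw [Set.uIcc_of_le (by linarith [pi_pos])]
    exact (continuousOn_div_cos continuous_const).pow 2
  rw [intervalIntegral.integral_eq_sub_of_hasDerivAt hderiv hInt, neg_div, tan_neg,
    tan_pi_div_four]
  norm_num

lemma fourierCoeffOn_inv_cos (h : -π < π) (n : ℤ) :
    fourierCoeffOn h (fun x => ((1 / cos (x / 4) : ℝ) : ℂ)) n =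
      ((secCoeff n / (2 * π) : ℝ) : ℂ) := by
  have hsin : ∫ x in (-π)..π, sin (n * x) / cos (x / 4) = 0 := by
    have hneg := intervalIntegral.integral_comp_neg (a := -π) (b := π)
      (fun x : ℝ => sin (n * x) / cos (x / 4))
    simp only [mul_neg, sin_neg, neg_div, cos_neg, intervalIntegral.integral_neg, neg_neg] at hneg
    linarith
  have hexp : ∀ x : ℝ, fourier (-n) (x : AddCircle (π - -π)) • ((1 / cos (x / 4) : ℝ) : ℂ) =
      ((cos (n * x) / cos (x / 4) : ℝ) : ℂ) -
        ((sin (n * x) / cos (x / 4) : ℝ) : ℂ) * Complex.I := by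
    intro x
    have harg : 2 * (π : ℂ) * Complex.I * ((-n : ℤ) : ℂ) * x / ((π - -π : ℝ) : ℂ) =
        ((-(n * x) : ℝ) : ℂ) * Complex.I := by
      have : (π : ℂ) ≠ 0 := by exact_mod_cast pi_ne_zero
      push_cast
      field_simp
      ring
    rw [fourier_coe_apply, harg, Complex.exp_mul_I, ← Complex.ofReal_cos, ← Complex.ofReal_sin,
      cos_neg, sin_neg, smul_eq_mul]
    push_cast
    ring
  have hInt {f : ℝ → ℝ} (hf : Continuous f) :
      IntervalIntegrable (fun x => ((f x / cos (x / 4) : ℝ) : ℂ)) volume (-π) π :=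
    ⟨(intervalIntegrable_div_cos hf).1.ofReal, (intervalIntegrable_div_cos hf).2.ofReal⟩
  rw [fourierCoeffOn_eq_integral]
  simp_rw [hexp]
  rw [intervalIntegral.integral_sub (hInt (by fun_prop)) ((hInt (by fun_prop)).mul_const _),
    intervalIntegral.integral_mul_const,
    intervalIntegral.integral_ofReal, intervalIntegral.integral_ofReal, hsin, ← secCoeff]
  simp only [Complex.ofReal_zero, zero_mul, sub_zero, Complex.real_smul]
  push_cast
  ring

lemma hasSum_secCoeff_sq :
    HasSum (fun n : ℕ => secCoeff n ^ 2) (8 * π + secCoeff 0 ^ 2 / 2) := by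
  have h : -π < π := by linarith [pi_pos]
  have hcont : ContinuousOn (fun x => ((1 / cos (x / 4) : ℝ) : ℂ)) (Set.Icc (-π) π) :=
    Complex.continuous_ofReal.comp_continuousOn (continuousOn_div_cos continuous_const)
  have hL2 : MemLp (fun x => ((1 / cos (x / 4) : ℝ) : ℂ)) 2
      (volume.restrict (Set.Ioc (-π) π)) := by
    obtain ⟨C, hC⟩ := isCompact_Icc.exists_bound_of_continuousOn hcont
    refine .of_bound ((hcont.mono Set.Ioc_subset_Icc_self).aestronglyMeasurable measurableSet_Ioc)
      C ?_
    filter_upwards [ae_restrict_mem measurableSet_Ioc] with x hx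
    exact hC x (Set.Ioc_subset_Icc_self hx)
  have hparseval := hasSum_sq_fourierCoeffOn h hL2
  simp only [fourierCoeffOn_inv_cos, Complex.norm_real, norm_eq_abs, sq_abs, integral_inv_cos_sq]
    at hparseval
  have hnat := (hparseval.nat_add_neg).mul_left (2 * π ^ 2)
  have heven : ∀ t : ℝ, secCoeff (-t) = secCoeff t := fun t => by
    simp [secCoeff]
  have hval : 2 * π ^ 2 * ((π - -π)⁻¹ • 8 + (secCoeff (0 : ℤ) / (2 * π)) ^ 2) =
      8 * π + secCoeff 0 ^ 2 / 2 := by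
    simp only [Int.cast_zero, smul_eq_mul]
    field_simp
    ring
  rw [hval] at hnat
  refine hnat.congr_fun fun n => ?_
  push_cast
  rw [heven]
  field_simp
  ring

lemma summable_innerTail_terms (n : ℕ) :
    Summable fun j : ℕ => (-1 : ℝ) ^ (n + 1 + j) *
      (1 / (4 * ((n : ℝ) + 1 + j) - 1) - 1 / (4 * ((n : ℝ) + 1 + j) - 3)) := by
  have hsq : Summable fun j : ℕ => 2 * (1 / ((j + 1 : ℕ) : ℝ) ^ 2) :=
    ((summable_nat_add_iff 1).2 (Real.summable_one_div_nat_pow.2 one_lt_two)).mul_left 2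
  refine hsq.of_norm_bounded fun j => ?_
  have hn : (0 : ℝ) ≤ n := n.cast_nonneg
  have hj : (0 : ℝ) ≤ j := j.cast_nonneg
  have h₁ : 0 < 4 * ((n : ℝ) + 1 + j) - 1 := by linarith
  have h₃ : 0 < 4 * ((n : ℝ) + 1 + j) - 3 := by linarith
  have hdiff : 1 / (4 * ((n : ℝ) + 1 + j) - 1) - 1 / (4 * ((n : ℝ) + 1 + j) - 3) =
      -(2 * (1 / ((4 * ((n : ℝ) + 1 + j) - 1) * (4 * ((n : ℝ) + 1 + j) - 3)))) := by
    field_simp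
    ring
  rw [norm_mul, norm_pow, norm_neg, norm_one, one_pow, one_mul, hdiff, norm_neg,
    norm_of_nonneg (by positivity)]
  push_cast
  gcongr
  nlinarith

lemma innerTail_eq_secCoeff (n : ℕ) : innerTail n = secCoeff n / (8 * √2) := by
  have hlim : Tendsto (fun n : ℕ => secCoeff n) atTop (𝓝 0) := by
    have h := hasSum_secCoeff_sq.summable.tendsto_atTop_zero
    simpa [sqrt_sq_eq_abs, tendsto_zero_iff_abs_tendsto_zero, Function.comp_def] using h.sqrt
  have hpartial (N : ℕ) : ∑ j ∈ Finset.range N, (-1 : ℝ) ^ (n + 1 + j) *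
      (1 / (4 * ((n : ℝ) + 1 + j) - 1) - 1 / (4 * ((n : ℝ) + 1 + j) - 3)) =
      (secCoeff n - secCoeff (n + N : ℕ)) / (8 * √2) := by
    have hterm (j : ℕ) : (-1 : ℝ) ^ (n + 1 + j) *
        (1 / (4 * ((n : ℝ) + 1 + j) - 1) - 1 / (4 * ((n : ℝ) + 1 + j) - 3)) =
        (secCoeff (n + j : ℕ) - secCoeff (n + (j + 1) : ℕ)) / (8 * √2) := by
      rw [← add_assoc n j 1, secCoeff_sub_succ, mul_div_cancel_left₀ _ (by positivity)]
      push_cast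
      ring_nf
    simp_rw [hterm]
    rw [← Finset.sum_div, Finset.sum_range_sub' fun j => secCoeff (n + j : ℕ), add_zero]
  refine tendsto_nhds_unique (summable_innerTail_terms n).hasSum.tendsto_sum_nat ?_
  simp_rw [hpartial]
  have hshift : Tendsto (fun N : ℕ => secCoeff (n + N : ℕ)) atTop (𝓝 0) := by
    simpa only [add_comm n] using (tendsto_add_atTop_iff_nat n).2 hlim
  simpa using (hshift.const_sub (secCoeff n)).div_const (8 * √2)

theorem stmt_1 :
    ∑' n : ℕ, (innerTail (n + 1)) ^ 2 =
      Real.pi / 16 - (1 / 4) * (Real.log (Real.sqrt 2 + 1)) ^ 2 := by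
  have h := (hasSum_nat_add_iff' 1).2 (hasSum_secCoeff_sq.div_const 128)
  have hsq (n : ℕ) : innerTail (n + 1) ^ 2 = secCoeff (n + 1 : ℕ) ^ 2 / 128 := by
    rw [innerTail_eq_secCoeff, div_pow, mul_pow, sq_sqrt zero_le_two]
    norm_num
  simp_rw [hsq]
  rw [h.tsum_eq]
  simp only [Finset.range_one, Finset.sum_singleton, Nat.cast_zero, secCoeff_zero]
  ring
end

section
/- Valdebenito's second identity: π² = −4·(ln(1+√2))² − 16·∫₀^{ln(1+√2)/2} ln(tanh x) dx. -/
open Real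

open Set

/-- The Legendre chi function of order two, `χ₂(x) = ∑ x ^ (2 n + 1) / (2 n + 1) ^ 2`. -/
noncomputable def legendreChiTwo (x : ℝ) : ℝ :=
  ∑' n : ℕ, x ^ (2 * n + 1) / (2 * (n : ℝ) + 1) ^ 2

theorem hasSum_one_div_odd_sq :
    HasSum (fun n : ℕ => 1 / (2 * (n : ℝ) + 1) ^ 2) (π ^ 2 / 8) := by
  have hodd : Summable fun n : ℕ => 1 / (2 * (n : ℝ) + 1) ^ 2 := by
    have := hasSum_zeta_two.summable.comp_injective
      (i := fun n : ℕ => 2 * n + 1) (fun a b h => by simpa using h)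
    refine this.congr fun n => ?_
    simp
  have heven : HasSum (fun n : ℕ => (1 : ℝ) / ((2 * n : ℕ) : ℝ) ^ 2) (1 / 4 * (π ^ 2 / 6)) := by
    have hterm : (fun n : ℕ => (1 : ℝ) / ((2 * n : ℕ) : ℝ) ^ 2) =
        fun n : ℕ => 1 / 4 * (1 / (n : ℝ) ^ 2) := by
      funext n
      rw [div_mul_div_comm, Nat.cast_mul, mul_pow]
      norm_num
    rw [hterm]
    exact hasSum_zeta_two.mul_left (1 / 4)
  have hsum : HasSum (fun n : ℕ => (1 : ℝ) / ((2 * n + 1 : ℕ) : ℝ) ^ 2)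
      (∑' n : ℕ, 1 / (2 * (n : ℝ) + 1) ^ 2) := by
    simpa using hodd.hasSum
  have h := (HasSum.even_add_odd (f := fun n : ℕ => (1 : ℝ) / (n : ℝ) ^ 2) heven hsum).unique
    hasSum_zeta_two
  have h8 : ∑' n : ℕ, 1 / (2 * (n : ℝ) + 1) ^ 2 = π ^ 2 / 8 := by linarith
  rw [← h8]
  exact hodd.hasSum

theorem legendreChiTwo_zero : legendreChiTwo 0 = 0 := by
  simp [legendreChiTwo]

theorem legendreChiTwo_one : legendreChiTwo 1 = π ^ 2 / 8 := by
  simpa [legendreChiTwo] using hasSum_one_div_odd_sq.tsum_eq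

theorem continuousOn_legendreChiTwo : ContinuousOn legendreChiTwo (Icc 0 1) := by
  refine continuousOn_tsum (fun n => by fun_prop) hasSum_one_div_odd_sq.summable fun n x hx => ?_
  rw [norm_of_nonneg (by have := hx.1; positivity)]
  gcongr
  exact pow_le_one₀ hx.1 hx.2

theorem hasDerivAt_legendreChiTwo {x : ℝ} (h0 : 0 < x) (h1 : x < 1) :
    HasDerivAt legendreChiTwo ((log (1 + x) - log (1 - x)) / (2 * x)) x := by
  obtain ⟨r, hxr, hr1⟩ := exists_between h1
  have hr0 : 0 < r := h0.trans hxr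
  have hu : Summable fun n : ℕ => (r ^ 2) ^ n :=
    summable_geometric_of_lt_one (by positivity) (by nlinarith)
  have key : HasDerivAt legendreChiTwo (∑' n : ℕ, x ^ (2 * n) / (2 * (n : ℝ) + 1)) x := by
    refine hasDerivAt_tsum_of_isPreconnected
      (g := fun (n : ℕ) (y : ℝ) => y ^ (2 * n + 1) / (2 * (n : ℝ) + 1) ^ 2)
      (g' := fun n y => y ^ (2 * n) / (2 * (n : ℝ) + 1)) (t := Ioo 0 r) (y₀ := x) hu isOpen_Ioo
      isPreconnected_Ioo (fun n y _ => ?_) (fun n y hy => ?_) ⟨h0, hxr⟩ ?_ ⟨h0, hxr⟩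
    · have h := (hasDerivAt_pow (2 * n + 1) y).div_const ((2 * (n : ℝ) + 1) ^ 2)
      refine h.congr_deriv ?_
      have : (2 * (n : ℝ) + 1) ≠ 0 := by positivity
      push_cast
      field_simp
    · have hy0 : 0 < y := hy.1
      rw [norm_of_nonneg (by positivity), ← pow_mul]
      calc y ^ (2 * n) / (2 * (n : ℝ) + 1) ≤ y ^ (2 * n) :=
            div_le_self (by positivity) (by linarith [n.cast_nonneg (α := ℝ)])
        _ ≤ r ^ (2 * n) := by gcongr; exact hy.2.le
    · refine Summable.of_nonneg_of_le (fun n => by positivity) (fun n => ?_)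
        hasSum_one_div_odd_sq.summable
      gcongr
      exact pow_le_one₀ h0.le h1.le
  refine key.congr_deriv ?_
  have hs := (hasSum_log_sub_log_of_abs_lt_one (abs_lt.2 ⟨by linarith, h1⟩)).div_const (2 * x)
  rw [← hs.tsum_eq]
  refine tsum_congr fun n => ?_
  have : (2 * (n : ℝ) + 1) ≠ 0 := by positivity
  rw [pow_succ]
  field_simp

theorem continuousOn_log_mul_log_sub_log :
    ContinuousOn (fun x : ℝ => log x * (log (1 + x) - log (1 - x))) (Ico 0 1) := by
  set f : ℝ → ℝ := fun x => log (1 + x) - log (1 - x) with hf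
  have hd : ∀ x ∈ Ioo (-1 : ℝ) 1, DifferentiableAt ℝ f x := fun x hx => by
    have h1 : 1 + x ≠ 0 := by linarith [hx.1]
    have h2 : 1 - x ≠ 0 := by linarith [hx.2]
    fun_prop (disch := assumption)
  have hslope : ContinuousOn (dslope f 0) (Ioo (-1) 1) :=
    (continuousOn_dslope (Ioo_mem_nhds (by norm_num) (by norm_num))).2
      ⟨fun x hx => (hd x hx).continuousAt.continuousWithinAt, hd 0 (by norm_num)⟩
  have heq : (fun x : ℝ => log x * f x) = fun x => (x * log x) * dslope f 0 x := by
    ext x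
    have h := sub_smul_dslope f 0 x
    have hf0 : f 0 = 0 := by simp [hf]
    rw [hf0, sub_zero, sub_zero, smul_eq_mul] at h
    rw [← h]
    ring
  rw [heq]
  exact continuous_mul_log.continuousOn.mul
    (hslope.mono fun x hx => ⟨by linarith [hx.1], hx.2⟩)

/-- Landen's functional equation for the Legendre chi function. -/
theorem legendreChiTwo_add_legendreChiTwo {x : ℝ} (h0 : 0 < x) (h1 : x < 1) :
    legendreChiTwo x + legendreChiTwo ((1 - x) / (1 + x)) =
      π ^ 2 / 8 + 1 / 2 * (log x * (log (1 + x) - log (1 - x))) := by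
  set F : ℝ → ℝ := fun y => legendreChiTwo y + legendreChiTwo ((1 - y) / (1 + y)) -
    1 / 2 * (log y * (log (1 + y) - log (1 - y))) with hF
  have hcont : ContinuousOn F (Icc 0 x) := by
    refine ((continuousOn_legendreChiTwo.mono (Icc_subset_Icc_right h1.le)).add
      (continuousOn_legendreChiTwo.comp (ContinuousOn.div (by fun_prop) (by fun_prop) ?_) ?_)).sub
      (continuousOn_const.mul (continuousOn_log_mul_log_sub_log.mono
        fun y hy => ⟨hy.1, hy.2.trans_lt h1⟩))
    · intro y hy
      linarith [hy.1]
    · intro y hy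
      have h2 : 0 < 1 + y := by linarith [hy.1]
      exact ⟨div_nonneg (by linarith [hy.2]) h2.le, (div_le_one h2).2 (by linarith [hy.1])⟩
  have hderiv : ∀ y ∈ Ioo 0 x, HasDerivAt F 0 y := by
    intro y hy
    have hy0 : 0 < y := hy.1
    have hp : 0 < 1 + y := by linarith
    have hm : 0 < 1 - y := by linarith [hy.2]
    have ht : HasDerivAt (fun z : ℝ => (1 - z) / (1 + z)) (-2 / (1 + y) ^ 2) y := by
      refine (((hasDerivAt_id y).const_sub 1).div ((hasDerivAt_id y).const_add 1)
        hp.ne').congr_deriv ?_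
      simp only [id]
      ring
    have hchi := (hasDerivAt_legendreChiTwo (x := (1 - y) / (1 + y)) (div_pos hm hp)
      ((div_lt_one hp).2 (by linarith))).comp y ht
    have hl1 := ((hasDerivAt_id y).const_add 1).log hp.ne'
    have hl2 := ((hasDerivAt_id y).const_sub 1).log hm.ne'
    have h := ((hasDerivAt_legendreChiTwo hy0 (hy.2.trans h1)).add hchi).sub
      (((hasDerivAt_log hy0.ne').mul (hl1.sub hl2)).const_mul (1 / 2))
    refine h.congr_deriv ?_
    have e1 : 1 + (1 - y) / (1 + y) = 2 / (1 + y) := by field_simp; ring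
    have e2 : 1 - (1 - y) / (1 + y) = 2 * y / (1 + y) := by field_simp; ring
    rw [e1, e2, log_div two_ne_zero hp.ne', log_div (by positivity) hp.ne',
      log_mul two_ne_zero hy0.ne']
    simp only [id, Pi.sub_apply]
    field_simp
    ring
  obtain ⟨c, _, hc⟩ := exists_hasDerivAt_eq_slope F (fun _ => 0) h0 hcont hderiv
  have hFx : F x = F 0 := by
    rw [eq_comm, div_eq_zero_iff] at hc
    rcases hc with hc | hc <;> linarith
  simp only [hF, log_zero, sub_zero, add_zero, div_one, zero_mul, mul_zero, legendreChiTwo_zero,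
    legendreChiTwo_one, zero_add] at hFx
  linarith

theorem log_tanh_eq {x : ℝ} (hx : 0 < x) :
    log (tanh x) = log (1 - exp (-2 * x)) - log (1 + exp (-2 * x)) := by
  have h1 : exp (-2 * x) < 1 := exp_lt_one_iff.2 (by linarith)
  rw [← log_div (by linarith) (by positivity), tanh_eq_sinh_div_cosh, sinh_eq, cosh_eq]
  congr 1
  have h2 : exp (-2 * x) = exp (-x) * exp (-x) := by rw [← exp_add]; ring_nf
  have h3 : exp x * exp (-x) = 1 := by rw [← exp_add]; simp
  rw [h2, div_div_div_cancel_right₀ two_ne_zero, div_eq_div_iff (by positivity) (by positivity)]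
  linear_combination (2 * exp (-x)) * h3

theorem integral_log_tanh {a : ℝ} (ha : 0 ≤ a) :
    ∫ x in (0 : ℝ)..a, log (tanh x) = legendreChiTwo (exp (-2 * a)) - π ^ 2 / 8 := by
  set G : ℝ → ℝ := fun x => legendreChiTwo (exp (-2 * x)) with hG
  have hcont : ContinuousOn G (Icc 0 a) :=
    continuousOn_legendreChiTwo.comp (by fun_prop) fun x hx =>
      ⟨(exp_pos _).le, exp_le_one_iff.2 (by linarith [hx.1])⟩
  have hderiv : ∀ x ∈ Ioo 0 a, HasDerivAt G (log (tanh x)) x := by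
    intro x hx
    have he : HasDerivAt (fun y : ℝ => exp (-2 * y)) (exp (-2 * x) * (-2)) x := by
      simpa using ((hasDerivAt_id x).const_mul (-2)).exp
    refine ((hasDerivAt_legendreChiTwo (exp_pos (-2 * x))
      (exp_lt_one_iff.2 (by linarith [hx.1]))).comp x he).congr_deriv ?_
    rw [log_tanh_eq hx.1]
    have := (exp_pos (-2 * x)).ne'
    field_simp
    ring
  have hint : IntervalIntegrable (fun x => log (tanh x)) MeasureTheory.volume 0 a := by
    have h : IntervalIntegrable (fun x => -log (tanh x)) MeasureTheory.volume 0 a := by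
      refine intervalIntegral.intervalIntegrable_deriv_of_nonneg (g := fun x => -G x) ?_ ?_ ?_
      · rw [uIcc_of_le ha]
        exact hcont.neg
      · rw [min_eq_left ha, max_eq_right ha]
        exact fun x hx => (hderiv x hx).neg
      · rw [min_eq_left ha, max_eq_right ha]
        intro x hx
        rw [log_tanh_eq hx.1, neg_sub, sub_nonneg]
        have h1 : exp (-2 * x) < 1 := exp_lt_one_iff.2 (by linarith [hx.1])
        exact log_le_log (by linarith) (by linarith [exp_pos (-2 * x)])
    simpa only [Pi.neg_def, neg_neg] using h.neg
  rw [intervalIntegral.integral_eq_sub_of_hasDerivAt_of_le ha hcont hderiv hint]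
  simp [hG, legendreChiTwo_one]

theorem legendreChiTwo_sqrt_two_sub_one :
    legendreChiTwo (√2 - 1) = π ^ 2 / 16 - log (1 + √2) ^ 2 / 4 := by
  have hs : √2 * √2 = 2 := mul_self_sqrt (by norm_num)
  have hs0 : 0 ≤ √2 := sqrt_nonneg 2
  have h1 : 0 < √2 - 1 := by nlinarith
  have h2 : √2 - 1 < 1 := by nlinarith
  have hpos : 0 < 1 + √2 := by positivity
  have h := legendreChiTwo_add_legendreChiTwo h1 h2
  have hfix : (1 - (√2 - 1)) / (1 + (√2 - 1)) = √2 - 1 := by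
    rw [div_eq_iff (by linarith)]
    linear_combination -hs
  have hinv : √2 - 1 = (1 + √2)⁻¹ := by
    refine eq_inv_of_mul_eq_one_left ?_
    linear_combination hs
  have hlog : log (1 + (√2 - 1)) - log (1 - (√2 - 1)) = log (1 + √2) := by
    rw [← neg_sub, ← log_div (by linarith) (by linarith), hfix, hinv, log_inv, neg_neg]
  have hlog' : log (√2 - 1) = -log (1 + √2) := by rw [hinv, log_inv]
  rw [hfix, hlog, hlog'] at h
  linear_combination h / 2

theorem stmt_9 :
    Real.pi ^ 2 =
      -4 * (Real.log (1 + Real.sqrt 2)) ^ 2 -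
        16 * ∫ x in (0 : ℝ)..(Real.log (1 + Real.sqrt 2) / 2), Real.log (Real.tanh x) := by
  have hpos : 0 < 1 + √2 := by positivity
  have hexp : exp (-2 * (log (1 + √2) / 2)) = √2 - 1 := by
    rw [show -2 * (log (1 + √2) / 2) = -log (1 + √2) by ring, exp_neg, exp_log hpos]
    refine inv_eq_of_mul_eq_one_right ?_
    linear_combination mul_self_sqrt (zero_le_two (α := ℝ))
  have hlog : 0 ≤ log (1 + √2) := log_nonneg (by linarith [sqrt_nonneg 2])
  rw [integral_log_tanh (by linarith), hexp, legendreChiTwo_sqrt_two_sub_one]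
  ring
end

section
/- ∫₀¹ arcsin((√2−1)x)/√(1−x²) dx = (1/4)·[ 4·Li₂(√2−1) − Li₂(3−2√2) ]. -/
open Real

/-- The dilogarithm, `Li₂(z) = ∑_{k=1}^∞ z^k / k²`. -/
noncomputable def Li2 (z : ℝ) : ℝ := ∑' k : ℕ, z ^ (k + 1) / ((k : ℝ) + 1) ^ 2

open Set MeasureTheory

theorem Li2_zero : Li2 0 = 0 := by simp [Li2]

theorem hasDerivAt_Li2_tsum {z : ℝ} (hz : |z| < 1) :
    HasDerivAt Li2 (∑' k : ℕ, z ^ k / ((k : ℝ) + 1)) z := by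
  obtain ⟨r, hzr, hr⟩ := exists_between hz
  have hr0 : 0 < r := (abs_nonneg z).trans_lt hzr
  refine hasDerivAt_tsum_of_isPreconnected (t := Ioo (-r) r) (y₀ := 0)
    (g := fun (k : ℕ) (z : ℝ) ↦ z ^ (k + 1) / ((k : ℝ) + 1) ^ 2)
    (g' := fun (k : ℕ) (z : ℝ) ↦ z ^ k / ((k : ℝ) + 1))
    (summable_geometric_of_lt_one hr0.le hr) isOpen_Ioo isPreconnected_Ioo
    (fun k y _ ↦ ?_) (fun k y hy ↦ ?_) ⟨by linarith, hr0⟩ ?_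
    (abs_lt.mp hzr)
  · have h := (hasDerivAt_pow (k + 1) y).div_const (((k : ℝ) + 1) ^ 2)
    have hk : (k : ℝ) + 1 ≠ 0 := by positivity
    convert! h using 1
    push_cast
    field_simp
  · rw [norm_div, norm_pow, Real.norm_eq_abs, Real.norm_of_nonneg (by positivity)]
    calc |y| ^ k / ((k : ℝ) + 1) ≤ |y| ^ k := div_le_self (by positivity) (by simp)
      _ ≤ r ^ k := by gcongr; exact (abs_lt.mpr hy).le
  · simp

theorem hasDerivAt_Li2 {z : ℝ} (hz : |z| < 1) (hz0 : z ≠ 0) :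
    HasDerivAt Li2 (-log (1 - z) / z) z := by
  convert! hasDerivAt_Li2_tsum hz using 1
  rw [← (hasSum_pow_div_log_of_abs_lt_one hz).tsum_eq, ← tsum_div_const]
  refine tsum_congr fun k ↦ ?_
  field_simp
  ring

theorem one_sub_sq_le_one_sub_sq_mul_sin_sq (a t : ℝ) :
    1 - a ^ 2 ≤ 1 - (a * sin t) ^ 2 := by
  nlinarith [sq_nonneg a, sin_sq_le_one t]

theorem abs_mul_sin_lt_one {a : ℝ} (ha : |a| < 1) (t : ℝ) : |a * sin t| < 1 := by
  rw [← sq_lt_one_iff_abs_lt_one] at ha ⊢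
  linarith [one_sub_sq_le_one_sub_sq_mul_sin_sq a t]

theorem hasDerivAt_integral_arcsin_mul_sin {a : ℝ} (ha : |a| < 1) :
    HasDerivAt (fun a ↦ ∫ t in (0 : ℝ)..π / 2, arcsin (a * sin t))
      (∫ t in (0 : ℝ)..π / 2, sin t / √(1 - (a * sin t) ^ 2)) a := by
  obtain ⟨r, har, hr⟩ := exists_between ha
  have hr0 : 0 < r := (abs_nonneg a).trans_lt har
  have hr2 : 0 < 1 - r ^ 2 := by nlinarith
  refine (intervalIntegral.hasDerivAt_integral_of_dominated_loc_of_deriv_le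
    (s := Ioo (-r) r) (F := fun a t ↦ arcsin (a * sin t))
    (F' := fun a t ↦ sin t / √(1 - (a * sin t) ^ 2))
    (bound := fun _ ↦ 1 / √(1 - r ^ 2))
    (isOpen_Ioo.mem_nhds (abs_lt.mp har)) ?_ ?_ ?_ ?_ (by simp) ?_).2
  · refine .of_forall fun x ↦ Continuous.aestronglyMeasurable ?_
    exact continuous_arcsin.comp (by fun_prop)
  · apply Continuous.intervalIntegrable
    exact continuous_arcsin.comp (by fun_prop)
  · exact Measurable.aestronglyMeasurable (by fun_prop)
  · refine .of_forall fun t _ x hx ↦ ?_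
    rw [norm_div, Real.norm_eq_abs, Real.norm_of_nonneg (sqrt_nonneg _)]
    have hx2 : x ^ 2 ≤ r ^ 2 := sq_le_sq' hx.1.le hx.2.le
    have := one_sub_sq_le_one_sub_sq_mul_sin_sq x t
    exact div_le_div₀ zero_le_one (abs_sin_le_one t) (sqrt_pos.mpr hr2) (sqrt_le_sqrt (by linarith))
  · refine .of_forall fun t _ x hx ↦ ?_
    have h := abs_lt.mp (abs_mul_sin_lt_one ((abs_lt.mpr hx).trans hr) t)
    convert! (hasDerivAt_arcsin h.1.ne' h.2.ne).comp x ((hasDerivAt_id x).mul_const (sin t)) using 1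
    simp; ring

theorem integral_sin_div_sqrt_one_sub_sq_mul_sin_sq {a : ℝ} (ha0 : a ≠ 0) (ha : |a| < 1) :
    ∫ t in (0 : ℝ)..π / 2, sin t / √(1 - (a * sin t) ^ 2) = artanh a / a := by
  have ha2 : 0 < 1 - a ^ 2 := by linarith [(sq_lt_one_iff_abs_lt_one a).mpr ha]
  have hpos (t : ℝ) : 0 < 1 - (a * sin t) ^ 2 :=
    ha2.trans_le (one_sub_sq_le_one_sub_sq_mul_sin_sq a t)
  have hs : √(1 - a ^ 2) ≠ 0 := (sqrt_pos.mpr ha2).ne'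
  rw [intervalIntegral.integral_eq_sub_of_hasDerivAt
    (f := fun t ↦ -(arsinh (a / √(1 - a ^ 2) * cos t) / a))]
  · have h : arsinh (a / √(1 - a ^ 2)) = artanh a := by
      rw [← sinh_artanh (abs_lt.mp ha), arsinh_sinh]
    simp [h]
  · intro t _
    convert! (((hasDerivAt_cos t).const_mul (a / √(1 - a ^ 2))).arsinh.div_const a).neg using 1
    have h : 1 + (a / √(1 - a ^ 2) * cos t) ^ 2 = (1 - (a * sin t) ^ 2) / (1 - a ^ 2) := by
      rw [mul_pow, div_pow, sq_sqrt ha2.le, mul_pow, sin_sq]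
      field_simp
      ring
    rw [h, sqrt_div (hpos t).le]
    have := (sqrt_pos.mpr (hpos t)).ne'
    simp only [smul_eq_mul]
    field_simp
  · refine (Continuous.div (by fun_prop) (by fun_prop) fun t ↦ ?_).intervalIntegrable _ _
    exact (sqrt_pos.mpr (hpos t)).ne'

theorem integral_arcsin_mul_sin {a : ℝ} (ha0 : 0 < a) (ha1 : a < 1) :
    ∫ t in (0 : ℝ)..π / 2, arcsin (a * sin t) = Li2 a - Li2 (a ^ 2) / 4 := by
  set F : ℝ → ℝ := fun a ↦ ∫ t in (0 : ℝ)..π / 2, arcsin (a * sin t) with hF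
  have habs {x : ℝ} (hx : x ∈ Icc 0 a) : |x| < 1 :=
    abs_lt.mpr ⟨by linarith [hx.1], by linarith [hx.2]⟩
  have habs2 {x : ℝ} (hx : x ∈ Icc 0 a) : |x ^ 2| < 1 := by
    rw [abs_pow]; exact pow_lt_one₀ (abs_nonneg x) (habs hx) two_ne_zero
  have hcont : ContinuousOn (fun x ↦ F x - (Li2 x - Li2 (x ^ 2) / 4)) (Icc 0 a) := by
    intro x hx
    have h2 : ContinuousAt (fun x ↦ Li2 (x ^ 2)) x :=
      ContinuousAt.comp (f := fun x : ℝ ↦ x ^ 2)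
        (hasDerivAt_Li2_tsum (habs2 hx)).continuousAt (by fun_prop)
    exact ((hasDerivAt_integral_arcsin_mul_sin (habs hx)).continuousAt.sub
      ((hasDerivAt_Li2_tsum (habs hx)).continuousAt.sub (h2.div_const 4))).continuousWithinAt
  have hderiv : ∀ x ∈ Ioo 0 a, HasDerivAt (fun x ↦ F x - (Li2 x - Li2 (x ^ 2) / 4)) 0 x := by
    intro x hx
    have hx' := Ioo_subset_Icc_self hx
    have hx0 : x ≠ 0 := hx.1.ne'
    have hx1 : x < 1 := hx.2.trans ha1
    have hpos : 0 < x := hx.1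
    have h2 : HasDerivAt (fun x ↦ Li2 (x ^ 2)) _ x :=
      HasDerivAt.comp (h := fun x : ℝ ↦ x ^ 2) x
        (hasDerivAt_Li2 (habs2 hx') (pow_ne_zero 2 hx0)) (hasDerivAt_pow 2 x)
    have h1 := hasDerivAt_integral_arcsin_mul_sin (habs hx')
    rw [integral_sin_div_sqrt_one_sub_sq_mul_sin_sq hx0 (habs hx')] at h1
    convert! h1.sub ((hasDerivAt_Li2 (habs hx') hx0).sub (h2.div_const 4)) using 1
    rw [artanh_eq_half_log ⟨by linarith, hx1.le⟩, log_div (by linarith) (by linarith),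
      show 1 - x ^ 2 = (1 + x) * (1 - x) by ring, log_mul (by linarith) (by linarith)]
    field_simp
    ring
  obtain ⟨c, -, h⟩ := exists_hasDerivAt_eq_slope _ (fun _ ↦ 0) ha0 hcont hderiv
  rw [eq_div_iff (by linarith)] at h
  have hF0 : F 0 = 0 := by simp [hF]
  simp only [hF0, Li2_zero, ne_eq, OfNat.ofNat_ne_zero, not_false_eq_true, zero_pow] at h
  change F a = _
  linarith

theorem integral_comp_arcsin_div_sqrt {g : ℝ → ℝ} (hg : Continuous g) :
    ∫ x in (0 : ℝ)..1, g (arcsin x) / √(1 - x ^ 2) = ∫ t in (0 : ℝ)..π / 2, g t := by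
  have hderiv : ∀ x ∈ Ioo (min (0 : ℝ) 1) (max 0 1), HasDerivAt arcsin (1 / √(1 - x ^ 2)) x := by
    intro x hx
    simp only [zero_le_one, min_eq_left, max_eq_right] at hx
    exact hasDerivAt_arcsin (by linarith [hx.1]) hx.2.ne
  have hint : IntervalIntegrable (fun x : ℝ ↦ 1 / √(1 - x ^ 2)) volume 0 1 :=
    intervalIntegral.intervalIntegrable_deriv_of_nonneg continuous_arcsin.continuousOn hderiv
      fun x _ ↦ by positivity
  have h := intervalIntegral.integral_comp_mul_deriv''' (g := g) continuous_arcsin.continuousOn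
    (fun x hx ↦ (hderiv x hx).hasDerivWithinAt) hg.continuousOn
    (hg.continuousOn.integrableOn_compact (isCompact_uIcc.image continuous_arcsin))
    ((intervalIntegrable_iff' (by finiteness)).mp
      (hint.continuousOn_mul (hg.comp continuous_arcsin).continuousOn))
  simpa [div_eq_mul_inv] using h

theorem stmt_12 :
    ∫ x in (0 : ℝ)..1, Real.arcsin ((Real.sqrt 2 - 1) * x) / Real.sqrt (1 - x ^ 2) =
      (1 / 4) * (4 * Li2 (Real.sqrt 2 - 1) - Li2 (3 - 2 * Real.sqrt 2)) := by
  have hs : √2 ^ 2 = 2 := sq_sqrt (by norm_num)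
  have h1 : 1 < √2 := by rw [lt_sqrt] <;> norm_num
  have h2 : √2 < 2 := by rw [sqrt_lt'] <;> norm_num
  have h := integral_arcsin_mul_sin (a := √2 - 1) (by linarith) (by linarith)
  rw [← integral_comp_arcsin_div_sqrt (g := fun t ↦ arcsin ((√2 - 1) * sin t))
    (continuous_arcsin.comp (by fun_prop))] at h
  rw [show 3 - 2 * √2 = (√2 - 1) ^ 2 by linear_combination -hs]
  trans Li2 (√2 - 1) - Li2 ((√2 - 1) ^ 2) / 4
  · rw [← h]
    refine intervalIntegral.integral_congr fun x hx ↦ ?_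
    rw [uIcc_of_le zero_le_one] at hx
    simp only [sin_arcsin (by linarith [hx.1] : -1 ≤ x) hx.2]
  · ring
end
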